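/- arXiv:2111.10834 — 4 statements merged into one kernel-verified Lean document; each statement's English description precedes it below -/
import Mathlib

section
/- Let d ≥ 1 and k ≥ d + 2. Let μ_1, …, μ_k ∈ ℝ^d and μ̄_1, …, μ̄_k ∈ ℝ^d be two configurations of points, and suppose the configuration μ_1, …, μ_k is reconstructible from its pairwise distances, i.e., for every configuration ν_1, …, ν_k ∈ ℝ^d whose multiset of pairwise squared distances {‖ν_i − ν_j‖² : 1 ≤ i < j ≤ k} equals {‖μ_i − μ_j‖² : 1 ≤ i < j ≤ k}, there exist a rigid motion g ∈ E(d) and a permutation σ of {1,…,k} such that ν_i = g(μ_{σ(i)}) for all i. Let ρ be the equally weighted mixture of the standard Gaussian densities centered at μ_1, …, μ_k, that is ρ(x) = (1/k) Σ_{i=1}^k (2π)^{−d/2} exp(−‖x − μ_i‖²/2), and let ρ̄ be the analogous equally weighted mixture with means μ̄_1, …, μ̄_k. If the law of ‖X_1 − X_2‖², where X_1, X_2 are independent samples from ρ, equals the law of ‖X̄_1 − X̄_2‖², where X̄_1, X̄_2 are independent samples from ρ̄, then there exist a rigid motion g ∈ E(d) and a permutation σ of {1,…,k} such that μ̄_i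 = g(μ_{σ(i)}) for all i (equivalently, ρ̄(x) = ρ(g^{−1}x) for all x). -/
open MeasureTheory

/-- The Gaussian-mixture density on `ℝ^d` with identity covariances,
weights `w i` and means `μ i`. -/
noncomputable def gaussMixture {d k : ℕ} (w : Fin k → ℝ)
    (μ : Fin k → EuclideanSpace ℝ (Fin d)) : EuclideanSpace ℝ (Fin d) → ℝ := fun x =>
  ∑ i, w i * ((2 * Real.pi) ^ (-(d : ℝ) / 2) * Real.exp (-‖x - μ i‖ ^ 2 / 2))

/-- The distribution of distances of a density `ρ` on `ℝ^d`: the law of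
`Δ = ‖X₁ - X₂‖²` where `X₁, X₂` are independent with density `ρ`, i.e. the pushforward of
the product of two copies of the measure with density `ρ` under the squared-distance map. -/
noncomputable def distDistrib {d : ℕ} (ρ : EuclideanSpace ℝ (Fin d) → ℝ) : Measure ℝ :=
  Measure.map
    (fun p : EuclideanSpace ℝ (Fin d) × EuclideanSpace ℝ (Fin d) => ‖p.1 - p.2‖ ^ 2)
    ((volume.withDensity fun x => ENNReal.ofReal (ρ x)).prod
      (volume.withDensity fun x => ENNReal.ofReal (ρ x)))

/-- The multiset of pairwise squared distances `{‖μ i - μ j‖² : i < j}` of a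
point configuration `μ : Fin k → ℝ^d`. -/
noncomputable def pairSqDists {d k : ℕ} (μ : Fin k → EuclideanSpace ℝ (Fin d)) : Multiset ℝ :=
  (Finset.univ.filter fun p : Fin k × Fin k => p.1 < p.2).val.map
    fun p => ‖μ p.1 - μ p.2‖ ^ 2

/-- A multiset over a field of characteristic zero is determined by its power sums. -/
theorem Multiset.eq_of_forall_sum_map_pow_eq {K : Type*} [Field K] [CharZero K]
    {s t : Multiset K} (h : ∀ n : ℕ, (s.map (· ^ n)).sum = (t.map (· ^ n)).sum) : s = t := by
  classical
  have hpoly : ∀ p : Polynomial K,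
      (s.map fun x => p.eval x).sum = (t.map fun x => p.eval x).sum := by
    intro p
    induction p using Polynomial.induction_on' with
    | add p q hp hq => simp [Multiset.sum_map_add, hp, hq]
    | monomial n a => simp [Polynomial.eval_monomial, Multiset.sum_map_mul_left, h n]
  ext v
  let P : Polynomial K :=
    ∏ u ∈ (s + t).toFinset.erase v, (Polynomial.X - Polynomial.C u)
  have hPv : P.eval v ≠ 0 := by
    simp only [P, Polynomial.eval_prod, Finset.prod_ne_zero_iff]
    intro u hu
    simpa [sub_eq_zero] using (Finset.ne_of_mem_erase hu).symm
  have hP : ∀ u ∈ s + t, u ≠ v → P.eval u = 0 := by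
    intro u hu huv
    simp only [P, Polynomial.eval_prod]
    exact Finset.prod_eq_zero
      (Finset.mem_erase.2 ⟨huv, Multiset.mem_toFinset.2 hu⟩) (by simp)
  have hcount : ∀ r : Multiset K, r ≤ s + t →
      (r.map fun x => P.eval x).sum = r.count v * P.eval v := by
    intro r hr
    rw [Finset.sum_multiset_map_count, Finset.sum_eq_single v]
    · simp
    · intro u hu huv
      simp [hP u (Multiset.mem_of_le hr (Multiset.mem_toFinset.1 hu)) huv]
    · intro hv
      simp [Multiset.count_eq_zero.2 (fun h' => hv (Multiset.mem_toFinset.2 h'))]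
  have := hpoly P
  rw [hcount s (Multiset.le_add_right _ _), hcount t (Multiset.le_add_left _ _)] at this
  exact_mod_cast mul_right_cancel₀ hPv this

/-- If the Laplace transforms of two finite multisets of reals agree near a point, then the
multisets are equal. -/
theorem Multiset.eq_of_eventually_sum_map_exp_eq {s t : Multiset ℝ} {a : ℝ}
    (h : ∀ᶠ c in nhds a, (s.map fun x => Real.exp (-(c * x))).sum
      = (t.map fun x => Real.exp (-(c * x))).sum) : s = t := by
  have han : ∀ r : Multiset ℝ,
      AnalyticOnNhd ℝ (fun c : ℝ => (r.map fun x => Real.exp (-(c * x))).sum) Set.univ := by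
    intro r c _
    induction r using Multiset.induction_on with
    | empty => simpa using analyticAt_const
    | cons x r ih =>
      simp only [Multiset.map_cons, Multiset.sum_cons]
      exact AnalyticAt.add (by fun_prop) ih
  have hall := (han s).eq_of_eventuallyEq (han t) h
  have hmap : s.map (fun x => Real.exp x) = t.map (fun x => Real.exp x) := by
    refine Multiset.eq_of_forall_sum_map_pow_eq fun n => ?_
    have := congrFun hall (-(n : ℝ))
    simpa [Multiset.map_map, Function.comp_def, ← Real.exp_nat_mul] using this
  exact Multiset.map_injective Real.exp_injective hmap

/-- Completing the square for a weighted sum of squared distances to two points. -/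
theorem add_mul_norm_sub_sq_eq {E : Type*} [NormedAddCommGroup E] [InnerProductSpace ℝ E]
    {α β : ℝ} (h : α + β ≠ 0) (x y a : E) :
    α * ‖x - y‖ ^ 2 + β * ‖x - a‖ ^ 2
      = (α + β) * ‖x - ((α / (α + β)) • y + (β / (α + β)) • a)‖ ^ 2
        + α * β / (α + β) * ‖y - a‖ ^ 2 := by
  have e1 : x - ((α / (α + β)) • y + (β / (α + β)) • a)
      = (α / (α + β)) • (x - y) + (β / (α + β)) • (x - a) := by
    have hx : x = (α / (α + β)) • x + (β / (α + β)) • x := by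
      rw [← add_smul, ← add_div, div_self h, one_smul]
    nth_rewrite 1 [hx]
    module
  have e2 : y - a = (x - a) - (x - y) := by abel
  rw [e1, e2, norm_add_sq_real, norm_sub_sq_real (x - a), norm_smul, norm_smul, mul_pow, mul_pow,
    inner_smul_left, inner_smul_right, real_inner_comm (x - y), Real.norm_eq_abs,
    Real.norm_eq_abs, sq_abs, sq_abs]
  simp only [conj_trivial]
  field_simp
  ring

section GaussianIntegrals

variable {E : Type*} [NormedAddCommGroup E] [InnerProductSpace ℝ E] [FiniteDimensional ℝ E]
  [MeasurableSpace E] [BorelSpace E]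

theorem lintegral_exp_neg_mul_norm_sub_sq {b : ℝ} (hb : 0 < b) (c : E) :
    ∫⁻ x : E, ENNReal.ofReal (Real.exp (-(b * ‖x - c‖ ^ 2)))
      = ENNReal.ofReal ((Real.pi / b) ^ (Module.finrank ℝ E / 2 : ℝ)) := by
  rw [lintegral_sub_right_eq_self
    (fun x : E => ENNReal.ofReal (Real.exp (-(b * ‖x‖ ^ 2)))) c]
  have hint := GaussianFourier.integral_rexp_neg_mul_sq_norm (V := E) hb
  have hpos : 0 < (Real.pi / b) ^ (Module.finrank ℝ E / 2 : ℝ) := by positivity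
  simp only [neg_mul] at hint
  rw [← hint, ofReal_integral_eq_lintegral_ofReal]
  · exact not_imp_comm.1 integral_undef (hint ▸ hpos.ne')
  · exact ae_of_all _ fun x => (Real.exp_pos _).le

theorem lintegral_exp_neg_mul_exp_neg {α β : ℝ} (hα : 0 < α) (hβ : 0 < β) (y a : E) :
    ∫⁻ x : E, ENNReal.ofReal (Real.exp (-(α * ‖x - y‖ ^ 2)))
        * ENNReal.ofReal (Real.exp (-(β * ‖x - a‖ ^ 2)))
      = ENNReal.ofReal ((Real.pi / (α + β)) ^ (Module.finrank ℝ E / 2 : ℝ))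
        * ENNReal.ofReal (Real.exp (-(α * β / (α + β) * ‖y - a‖ ^ 2))) := by
  have hab : 0 < α + β := by positivity
  rw [← lintegral_exp_neg_mul_norm_sub_sq hab ((α / (α + β)) • y + (β / (α + β)) • a),
    ← lintegral_mul_const _ (by fun_prop)]
  refine lintegral_congr fun x => ?_
  rw [← ENNReal.ofReal_mul (Real.exp_pos _).le, ← ENNReal.ofReal_mul (Real.exp_pos _).le,
    ← Real.exp_add, ← Real.exp_add]
  congr 2
  linarith [add_mul_norm_sub_sq_eq hab.ne' x y a]

/-- The Laplace transform of the squared distance between two Gaussian vectors, up to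
normalization, depends on the means only through `exp (-(t / (4 * t + 1) * ‖a - b‖ ^ 2))`. -/
theorem lintegral_lintegral_exp_neg_norm_sub_sq {t : ℝ} (ht : 0 < t) (a b : E) :
    ∫⁻ y : E, ∫⁻ x : E, ENNReal.ofReal (Real.exp (-(t * ‖x - y‖ ^ 2)))
        * (ENNReal.ofReal (Real.exp (-(1 / 2 * ‖x - a‖ ^ 2)))
        * ENNReal.ofReal (Real.exp (-(1 / 2 * ‖y - b‖ ^ 2))))
      = ENNReal.ofReal ((Real.pi / (t + 1 / 2)) ^ (Module.finrank ℝ E / 2 : ℝ)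
          * (Real.pi / (t / (2 * t + 1) + 1 / 2)) ^ (Module.finrank ℝ E / 2 : ℝ))
        * ENNReal.ofReal (Real.exp (-(t / (4 * t + 1) * ‖a - b‖ ^ 2))) := by
  have hs : 0 < t / (2 * t + 1) := by positivity
  have h1 : t * (1 / 2) / (t + 1 / 2) = t / (2 * t + 1) := by field_simp
  have h2 : t / (2 * t + 1) * (1 / 2) / (t / (2 * t + 1) + 1 / 2) = t / (4 * t + 1) := by
    field_simp
    ring
  have hinner : ∀ y : E, ∫⁻ x : E, ENNReal.ofReal (Real.exp (-(t * ‖x - y‖ ^ 2)))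
        * (ENNReal.ofReal (Real.exp (-(1 / 2 * ‖x - a‖ ^ 2)))
        * ENNReal.ofReal (Real.exp (-(1 / 2 * ‖y - b‖ ^ 2))))
      = ENNReal.ofReal ((Real.pi / (t + 1 / 2)) ^ (Module.finrank ℝ E / 2 : ℝ))
        * (ENNReal.ofReal (Real.exp (-(t / (2 * t + 1) * ‖y - a‖ ^ 2)))
        * ENNReal.ofReal (Real.exp (-(1 / 2 * ‖y - b‖ ^ 2)))) := by
    intro y
    simp only [← mul_assoc]
    rw [lintegral_mul_const _ (by fun_prop),
      lintegral_exp_neg_mul_exp_neg ht one_half_pos y a, h1]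
  simp only [hinner]
  rw [lintegral_const_mul _ (by fun_prop), lintegral_exp_neg_mul_exp_neg hs one_half_pos a b, h2,
    ENNReal.ofReal_mul (by positivity), mul_assoc]

end GaussianIntegrals

@[fun_prop]
theorem measurable_gaussMixture {d k : ℕ} (w : Fin k → ℝ)
    (μ : Fin k → EuclideanSpace ℝ (Fin d)) : Measurable (gaussMixture w μ) := by
  unfold gaussMixture
  fun_prop

theorem ofReal_gaussMixture {d k : ℕ} {c : ℝ} (hc : 0 ≤ c)
    (μ : Fin k → EuclideanSpace ℝ (Fin d)) (x : EuclideanSpace ℝ (Fin d)) :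
    ENNReal.ofReal (gaussMixture (fun _ => c) μ x)
      = ENNReal.ofReal (c * (2 * Real.pi) ^ (-(d : ℝ) / 2))
        * ∑ i, ENNReal.ofReal (Real.exp (-(1 / 2 * ‖x - μ i‖ ^ 2))) := by
  rw [← ENNReal.ofReal_sum_of_nonneg fun _ _ => (Real.exp_pos _).le,
    ← ENNReal.ofReal_mul (by positivity), gaussMixture, Finset.mul_sum]
  congr 1
  refine Finset.sum_congr rfl fun i _ => ?_
  rw [mul_assoc]
  congr 3
  ring

/-- The Laplace transform of the distribution of distances of an equally weighted mixture. -/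
theorem lintegral_exp_neg_distDistrib_gaussMixture {d k : ℕ} {c t : ℝ} (hc : 0 ≤ c) (ht : 0 < t)
    (μ : Fin k → EuclideanSpace ℝ (Fin d)) :
    ∫⁻ z, ENNReal.ofReal (Real.exp (-(t * z))) ∂distDistrib (gaussMixture (fun _ => c) μ)
      = ENNReal.ofReal (c * (2 * Real.pi) ^ (-(d : ℝ) / 2)) ^ 2
        * (ENNReal.ofReal ((Real.pi / (t + 1 / 2)) ^ (d / 2 : ℝ)
          * (Real.pi / (t / (2 * t + 1) + 1 / 2)) ^ (d / 2 : ℝ))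
        * ENNReal.ofReal (∑ p : Fin k × Fin k,
            Real.exp (-(t / (4 * t + 1) * ‖μ p.1 - μ p.2‖ ^ 2)))) := by
  have hρ := (measurable_gaussMixture (fun _ => c) μ).ennreal_ofReal
  have hkey : ∀ p : Fin k × Fin k, _ := fun p =>
    lintegral_lintegral_exp_neg_norm_sub_sq ht (μ p.1) (μ p.2)
  simp only [finrank_euclideanSpace_fin] at hkey
  rw [distDistrib, lintegral_map (by fun_prop) (by fun_prop),
    prod_withDensity hρ hρ, lintegral_withDensity_eq_lintegral_mul _ (by fun_prop) (by fun_prop),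
    lintegral_prod_symm' _ (by fun_prop),
    ENNReal.ofReal_sum_of_nonneg fun _ _ => (Real.exp_pos _).le, Finset.mul_sum]
  simp only [← hkey]
  rw [← lintegral_finsetSum _ fun p _ => by fun_prop, ← lintegral_const_mul _ (by fun_prop)]
  refine lintegral_congr fun y => ?_
  rw [← lintegral_finsetSum _ fun p _ => by fun_prop, ← lintegral_const_mul _ (by fun_prop)]
  refine lintegral_congr fun x => ?_
  simp only [Pi.mul_apply, ofReal_gaussMixture hc]
  rw [← Finset.mul_sum, Fintype.sum_prod_type]
  dsimp only
  rw [← Finset.sum_mul_sum]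
  ring

/-- Splitting a symmetric sum over all pairs into its diagonal and its upper triangle. -/
theorem sum_apply_norm_sub_sq_eq {d k : ℕ} (f : ℝ → ℝ) (μ : Fin k → EuclideanSpace ℝ (Fin d)) :
    ∑ p : Fin k × Fin k, f (‖μ p.1 - μ p.2‖ ^ 2)
      = k * f 0 + 2 * ((pairSqDists μ).map f).sum := by
  have hlt : ((pairSqDists μ).map f).sum
      = ∑ p : Fin k × Fin k, if p.1 < p.2 then f (‖μ p.1 - μ p.2‖ ^ 2) else 0 := by
    rw [← Finset.sum_filter, pairSqDists, Multiset.map_map]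
    rfl
  have hgt : ((pairSqDists μ).map f).sum
      = ∑ p : Fin k × Fin k, if p.2 < p.1 then f (‖μ p.1 - μ p.2‖ ^ 2) else 0 := by
    rw [hlt, ← (Equiv.prodComm (Fin k) (Fin k)).sum_comp]
    simp [norm_sub_rev]
  have hdiag : (k : ℝ) * f 0
      = ∑ p : Fin k × Fin k, if p.1 = p.2 then f (‖μ p.1 - μ p.2‖ ^ 2) else 0 := by
    simp [Fintype.sum_prod_type]
  rw [two_mul, hdiag]
  nth_rewrite 1 [hlt]
  rw [hgt, ← Finset.sum_add_distrib, ← Finset.sum_add_distrib]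
  refine Finset.sum_congr rfl fun p _ => ?_
  rcases lt_trichotomy p.1 p.2 with h | h | h
  · simp [h, h.ne, h.not_gt]
  · simp [h]
  · simp [h, h.ne', h.not_gt]

/-- The distribution of distances of an equally weighted mixture determines the multiset of
pairwise squared distances of its means. -/
theorem pairSqDists_eq_of_distDistrib_gaussMixture_eq {d k : ℕ} {c : ℝ} (hc : 0 < c)
    {μ ν : Fin k → EuclideanSpace ℝ (Fin d)}
    (h : distDistrib (gaussMixture (fun _ => c) μ) = distDistrib (gaussMixture (fun _ => c) ν)) :
    pairSqDists μ = pairSqDists ν := by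
  have hI : Set.Ioo (0 : ℝ) (1 / 4) ∈ nhds (1 / 8 : ℝ) :=
    Ioo_mem_nhds (by norm_num) (by norm_num)
  refine Multiset.eq_of_eventually_sum_map_exp_eq (a := 1 / 8) ?_
  filter_upwards [hI] with s hs
  have hs' : 0 < 1 - 4 * s := by linarith [hs.2]
  have ht : 0 < s / (1 - 4 * s) := div_pos hs.1 hs'
  have hst : s / (1 - 4 * s) / (4 * (s / (1 - 4 * s)) + 1) = s := by
    have hne := hs'.ne'
    have hden : 4 * (s / (1 - 4 * s)) + 1 = 1 / (1 - 4 * s) := by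
      rw [← mul_div_assoc, div_add_one hne, add_sub_cancel]
    rw [hden, div_div_div_cancel_right₀ hne, div_one]
  have hL := lintegral_exp_neg_distDistrib_gaussMixture hc.le ht μ
  rw [h, lintegral_exp_neg_distDistrib_gaussMixture hc.le ht ν, hst] at hL
  rw [ENNReal.mul_right_inj (pow_ne_zero _ (ENNReal.ofReal_pos.2 (by positivity)).ne')
      (ENNReal.pow_ne_top ENNReal.ofReal_ne_top),
    ENNReal.mul_right_inj (ENNReal.ofReal_pos.2 (by positivity)).ne' ENNReal.ofReal_ne_top,
    ENNReal.ofReal_eq_ofReal_iff (Finset.sum_nonneg fun _ _ => (Real.exp_pos _).le)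
      (Finset.sum_nonneg fun _ _ => (Real.exp_pos _).le),
    sum_apply_norm_sub_sq_eq (fun x => Real.exp (-(s * x))),
    sum_apply_norm_sub_sq_eq (fun x => Real.exp (-(s * x)))] at hL
  linarith

/-- If two equally weighted identity-covariance Gaussian mixtures, one of whose mean
configurations is reconstructible from its pairwise distances, have the same distribution of
distances, then their mean configurations agree up to a rigid motion and a permutation. -/
theorem equal_weight_mixture_determined_by_distance_distribution
    (d k : ℕ) (hd : 1 ≤ d) (hk : d + 2 ≤ k)
    (μ μbar : Fin k → EuclideanSpace ℝ (Fin d))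
    (hrec : ∀ ν : Fin k → EuclideanSpace ℝ (Fin d),
      pairSqDists ν = pairSqDists μ →
      ∃ (g : EuclideanSpace ℝ (Fin d) ≃ᵢ EuclideanSpace ℝ (Fin d)) (σ : Equiv.Perm (Fin k)),
        ∀ i, ν i = g (μ (σ i)))
    (hlaw : distDistrib (gaussMixture (fun _ => (1 : ℝ) / k) μ)
          = distDistrib (gaussMixture (fun _ => (1 : ℝ) / k) μbar)) :
    ∃ (g : EuclideanSpace ℝ (Fin d) ≃ᵢ EuclideanSpace ℝ (Fin d)) (σ : Equiv.Perm (Fin k)),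
      ∀ i, μbar i = g (μ (σ i)) := by
  have hk0 : 0 < k := by omega
  exact hrec μbar (pairSqDists_eq_of_distDistrib_gaussMixture_eq (by positivity) hlaw).symm
end

section
/- Let d ≥ 1 and k ≥ d + 2. Let μ_1, …, μ_k ∈ ℝ^d be points whose pairwise distances ‖μ_i − μ_j‖ (1 ≤ i < j ≤ k) are pairwise distinct, and suppose the configuration μ_1, …, μ_k is reconstructible from its pairwise distances, i.e., for every configuration ν_1, …, ν_k ∈ ℝ^d whose multiset of pairwise squared distances equals {‖μ_i − μ_j‖² : 1 ≤ i < j ≤ k}, there exist a rigid motion g ∈ E(d) and a permutation σ of {1,…,k} with ν_i = g(μ_{σ(i)}) for all i. Let π_1, …, π_k > 0 with Σπ_i = 1 and let ρ(x) = Σ_{i=1}^k π_i (2π)^{−d/2} exp(−‖x − μ_i‖²/2). Let ρ̄ be another Gaussian mixture of k identity-covariance components with positive weights π̄_1,…,π̄_k summing to 1 and means μ̄_1,…,μ̄_k. If the law of ‖X_1 − X_2‖² for X_1, X_2 independent samples from ρ equals the law of ‖X̄_1 − X̄_2‖² for X̄_1, X̄_2 independent samples from ρ̄, then there exist a rigid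 motion g ∈ E(d) and a permutation σ of {1,…,k} such that μ̄_i = g(μ_{σ(i)}) and π̄_i = π_{σ(i)} for all i (equivalently, ρ̄(x) = ρ(g^{−1}x) for all x). -/
open MeasureTheory

theorem integrable_exp_neg_mul_sq_norm_sub {d : ℕ} {a : ℝ} (ha : 0 < a)
    (p : EuclideanSpace ℝ (Fin d)) :
    Integrable fun x : EuclideanSpace ℝ (Fin d) => Real.exp (-a * ‖x - p‖ ^ 2) := by
  have h := GaussianFourier.integrable_cexp_neg_mul_sq_norm_add (V := EuclideanSpace ℝ (Fin d))
    (b := (a : ℂ)) (by simpa using ha) 0 0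
  have h2 := (h.re).comp_sub_right p
  refine h2.congr (.of_forall fun x => ?_)
  simp only [zero_mul, add_zero, inner_zero_left]
  rw [← Complex.exp_ofReal_re]
  simp

theorem complete_square {V : Type*} [NormedAddCommGroup V] [InnerProductSpace ℝ V] {a b : ℝ}
    (h : 0 < a + b) (x p q : V) :
    a * ‖x - p‖ ^ 2 + b * ‖x - q‖ ^ 2 =
      (a + b) * ‖x - (a + b)⁻¹ • (a • p + b • q)‖ ^ 2 + a * b / (a + b) * ‖p - q‖ ^ 2 := by
  simp only [← real_inner_self_eq_norm_sq, inner_sub_left, inner_sub_right, inner_add_left,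
    inner_add_right, real_inner_smul_left, real_inner_smul_right, real_inner_comm x p,
    real_inner_comm x q, real_inner_comm p q]
  field_simp
  ring

theorem exp_mul_exp_eq {d : ℕ} {a b : ℝ} (h : 0 < a + b) (x p q : EuclideanSpace ℝ (Fin d)) :
    Real.exp (-a * ‖x - p‖ ^ 2) * Real.exp (-b * ‖x - q‖ ^ 2) =
      Real.exp (-(a + b) * ‖x - (a + b)⁻¹ • (a • p + b • q)‖ ^ 2) *
        Real.exp (-(a * b / (a + b)) * ‖p - q‖ ^ 2) := by
  rw [← Real.exp_add, ← Real.exp_add]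
  congr 1
  linarith [complete_square h x p q]

theorem integral_exp_mul_exp {d : ℕ} {a b : ℝ} (h : 0 < a + b) (p q : EuclideanSpace ℝ (Fin d)) :
    ∫ x, Real.exp (-a * ‖x - p‖ ^ 2) * Real.exp (-b * ‖x - q‖ ^ 2) =
      (Real.pi / (a + b)) ^ ((d : ℝ) / 2) * Real.exp (-(a * b / (a + b)) * ‖p - q‖ ^ 2) := by
  simp_rw [exp_mul_exp_eq h _ p q]
  rw [integral_mul_const, integral_sub_right_eq_self
    (fun x : EuclideanSpace ℝ (Fin d) => Real.exp (-(a + b) * ‖x‖ ^ 2)),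
    GaussianFourier.integral_rexp_neg_mul_sq_norm h]
  simp

/-- Linear independence of exponentials: exponential sums that agree on an interval put the same
total coefficient on every exponent. -/
theorem sum_filter_eq_of_sum_exp_eq {ι : Type*} [Fintype ι] {ε : ℝ} (hε : 0 < ε)
    {c c' p p' : ι → ℝ}
    (h : ∀ t ∈ Set.Ioo 0 ε, ∑ i, c i * Real.exp (-t * p i) = ∑ i, c' i * Real.exp (-t * p' i))
    (v : ℝ) : ∑ i with p i = v, c i = ∑ i with p' i = v, c' i := by
  classical
  have hall : (fun t => ∑ i, c i * Real.exp (-t * p i)) =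
      fun t => ∑ i, c' i * Real.exp (-t * p' i) := by
    refine AnalyticOnNhd.eq_of_eventuallyEq (𝕜 := ℝ) (z₀ := ε / 2) ?_ ?_ ?_
    · intro t _; fun_prop
    · intro t _; fun_prop
    · filter_upwards [Ioo_mem_nhds (half_pos hε) (half_lt_self hε)] with t ht using h t ht
  let χ : ℝ → (Multiplicative ℝ →* ℝ) := fun v =>
    { toFun := fun t => Real.exp (-t.toAdd * v)
      map_one' := by simp
      map_mul' := fun s t => by simp [← Real.exp_add]; ring_nf }
  have hχ : Function.Injective χ := fun u v huv => by
    have := DFunLike.congr_fun huv (Multiplicative.ofAdd 1)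
    simpa [χ] using this
  have hli := (linearIndependent_monoidHom (Multiplicative ℝ) ℝ).comp χ hχ
  have := linearIndependent_iff_injective_finsuppLinearCombination.mp hli
    (a₁ := ∑ i, Finsupp.single (p i) (c i)) (a₂ := ∑ i, Finsupp.single (p' i) (c' i)) (by
      simp only [map_sum, Finsupp.linearCombination_single]
      ext t
      simpa [χ] using congr_fun hall t.toAdd)
  have h2 := DFunLike.congr_fun this v
  simpa [Finsupp.finsetSum_apply, Finsupp.single_apply, Finset.sum_filter] using h2

theorem lintegral_exp_withDensity_gaussMixture {d k : ℕ} {w : Fin k → ℝ} (hw : ∀ i, 0 < w i)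
    (μ : Fin k → EuclideanSpace ℝ (Fin d)) {a : ℝ} (ha : 0 < a) (p : EuclideanSpace ℝ (Fin d)) :
    ∫⁻ x, ENNReal.ofReal (Real.exp (-a * ‖x - p‖ ^ 2))
        ∂(volume.withDensity fun x => ENNReal.ofReal (gaussMixture w μ x)) =
      ENNReal.ofReal ((2 * Real.pi) ^ (-(d : ℝ) / 2) * (Real.pi / (a + 1 / 2)) ^ ((d : ℝ) / 2) *
        ∑ i, w i * Real.exp (-(a / (2 * a + 1)) * ‖p - μ i‖ ^ 2)) := by
  have hsplit : ∀ x, gaussMixture w μ x * Real.exp (-a * ‖x - p‖ ^ 2) =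
      ∑ i, w i * (2 * Real.pi) ^ (-(d : ℝ) / 2) *
        (Real.exp (-a * ‖x - p‖ ^ 2) * Real.exp (-(1 / 2) * ‖x - μ i‖ ^ 2)) := by
    intro x
    rw [gaussMixture, Finset.sum_mul]
    refine Finset.sum_congr rfl fun i _ => ?_
    rw [show -(1 / 2) * ‖x - μ i‖ ^ 2 = -‖x - μ i‖ ^ 2 / 2 by ring]
    ring
  have hpos : 0 < a + 1 / 2 := by positivity
  have hint : ∀ i, Integrable fun x : EuclideanSpace ℝ (Fin d) =>
      w i * (2 * Real.pi) ^ (-(d : ℝ) / 2) *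
        (Real.exp (-a * ‖x - p‖ ^ 2) * Real.exp (-(1 / 2) * ‖x - μ i‖ ^ 2)) := by
    intro i
    simp_rw [exp_mul_exp_eq hpos _ p (μ i)]
    exact ((integrable_exp_neg_mul_sq_norm_sub hpos _).mul_const _).const_mul _
  have hmeas : Measurable (gaussMixture w μ) := by
    unfold gaussMixture; fun_prop
  have hnn : ∀ x, 0 ≤ gaussMixture w μ x := fun x =>
    Finset.sum_nonneg fun i _ => mul_nonneg (hw i).le (by positivity)
  rw [lintegral_withDensity_eq_lintegral_mul _ (by fun_prop) (by fun_prop)]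
  simp only [Pi.mul_apply, ← ENNReal.ofReal_mul (hnn _)]
  rw [← ofReal_integral_eq_lintegral_ofReal]
  · simp_rw [hsplit]
    rw [integral_finsetSum _ fun i _ => hint i, Finset.mul_sum]
    congr 1
    refine Finset.sum_congr rfl fun i _ => ?_
    rw [integral_const_mul, integral_exp_mul_exp hpos,
      show a * (1 / 2) / (a + 1 / 2) = a / (2 * a + 1) by field_simp]
    ring
  · simp_rw [hsplit]
    exact integrable_finsetSum _ fun i _ => hint i
  · exact .of_forall fun x => mul_nonneg (hnn x) (Real.exp_nonneg _)

theorem lintegral_exp_distDistrib_gaussMixture {d k : ℕ} {w : Fin k → ℝ} (hw : ∀ i, 0 < w i)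
    (μ : Fin k → EuclideanSpace ℝ (Fin d)) {s : ℝ} (hs : 0 < s) :
    ∫⁻ u, ENNReal.ofReal (Real.exp (-s * u)) ∂(distDistrib (gaussMixture w μ)) =
      ENNReal.ofReal (((2 * Real.pi) ^ (-(d : ℝ) / 2) *
        (Real.pi / (s + 1 / 2)) ^ ((d : ℝ) / 2)) *
        ((2 * Real.pi) ^ (-(d : ℝ) / 2) *
        (Real.pi / (s / (2 * s + 1) + 1 / 2)) ^ ((d : ℝ) / 2)) *
        ∑ q : Fin k × Fin k, w q.1 * w q.2 *
          Real.exp (-(s / (4 * s + 1)) * ‖μ q.1 - μ q.2‖ ^ 2)) := by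
  rw [distDistrib, lintegral_map (by fun_prop) (by fun_prop),
    lintegral_prod_symm' _ (by fun_prop)]
  simp only [lintegral_exp_withDensity_gaussMixture hw μ hs]
  set C := (2 * Real.pi) ^ (-(d : ℝ) / 2) * (Real.pi / (s + 1 / 2)) ^ ((d : ℝ) / 2)
  set C' := (2 * Real.pi) ^ (-(d : ℝ) / 2) * (Real.pi / (s / (2 * s + 1) + 1 / 2)) ^ ((d : ℝ) / 2)
  have hC : 0 ≤ C := by positivity
  have hC'0 : 0 ≤ C' := by positivity
  have hnn : ∀ i, 0 ≤ C * w i := fun i => mul_nonneg hC (hw i).le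
  have hsplit : ∀ y, ENNReal.ofReal (C * ∑ i, w i *
      Real.exp (-(s / (2 * s + 1)) * ‖y - μ i‖ ^ 2)) =
      ∑ i, ENNReal.ofReal (C * w i) *
        ENNReal.ofReal (Real.exp (-(s / (2 * s + 1)) * ‖y - μ i‖ ^ 2)) := by
    intro y
    rw [Finset.mul_sum, ENNReal.ofReal_sum_of_nonneg]
    · refine Finset.sum_congr rfl fun i _ => ?_
      rw [← ENNReal.ofReal_mul (hnn i), mul_assoc C]
    · intro i _
      rw [← mul_assoc]
      exact mul_nonneg (hnn i) (Real.exp_nonneg _)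
  simp_rw [hsplit]
  rw [lintegral_finsetSum _ fun i _ => by fun_prop]
  have hs' : 0 < s / (2 * s + 1) := by positivity
  have key : s / (2 * s + 1) / (2 * (s / (2 * s + 1)) + 1) = s / (4 * s + 1) := by
    field_simp
    ring
  have hterm : ∀ i, ∫⁻ y, ENNReal.ofReal (C * w i) *
      ENNReal.ofReal (Real.exp (-(s / (2 * s + 1)) * ‖y - μ i‖ ^ 2))
        ∂(volume.withDensity fun x => ENNReal.ofReal (gaussMixture w μ x)) =
      ENNReal.ofReal (C * w i * (C' * ∑ j, w j *
        Real.exp (-(s / (4 * s + 1)) * ‖μ i - μ j‖ ^ 2))) := by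
    intro i
    rw [lintegral_const_mul _ (by fun_prop), lintegral_exp_withDensity_gaussMixture hw μ hs', key,
      ← ENNReal.ofReal_mul (hnn i)]
  simp_rw [hterm]
  rw [← ENNReal.ofReal_sum_of_nonneg, Fintype.sum_prod_type]
  · simp only [Finset.mul_sum]
    congr 1
    refine Finset.sum_congr rfl fun i _ => Finset.sum_congr rfl fun j _ => ?_
    ring
  · intro i _
    exact mul_nonneg (hnn i) (mul_nonneg hC'0 (Finset.sum_nonneg fun j _ =>
      mul_nonneg (hw j).le (Real.exp_nonneg _)))

/-- Equal distance distributions of Gaussian mixtures carry equal weight on each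
squared distance between means. -/
theorem sum_filter_sqDist_eq {d k : ℕ} {w w' : Fin k → ℝ} (hw : ∀ i, 0 < w i)
    (hw' : ∀ i, 0 < w' i) {μ μ' : Fin k → EuclideanSpace ℝ (Fin d)}
    (h : distDistrib (gaussMixture w μ) = distDistrib (gaussMixture w' μ')) (v : ℝ) :
    ∑ q : Fin k × Fin k with ‖μ q.1 - μ q.2‖ ^ 2 = v, w q.1 * w q.2 =
      ∑ q : Fin k × Fin k with ‖μ' q.1 - μ' q.2‖ ^ 2 = v, w' q.1 * w' q.2 := by
  refine sum_filter_eq_of_sum_exp_eq (ε := 1 / 4) (by norm_num) (fun t ht => ?_) v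
  obtain ⟨ht0, ht1⟩ := ht
  have h4 : 0 < 1 - 4 * t := by linarith
  have hs : 0 < t / (1 - 4 * t) := by positivity
  have hst : t / (1 - 4 * t) / (4 * (t / (1 - 4 * t)) + 1) = t := by
    have hne : 4 * (t / (1 - 4 * t)) + 1 = 1 / (1 - 4 * t) := by
      field_simp
      ring
    rw [hne, div_div_div_cancel_right₀ h4.ne', div_one]
  have H := lintegral_exp_distDistrib_gaussMixture hw μ hs
  rw [h, lintegral_exp_distDistrib_gaussMixture hw' μ' hs, hst,
    ENNReal.ofReal_eq_ofReal_iff] at H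
  · exact (mul_left_cancel₀ (by positivity) H).symm
  · exact mul_nonneg (by positivity) (Finset.sum_nonneg fun q _ =>
      mul_nonneg (mul_pos (hw' _) (hw' _)).le (Real.exp_nonneg _))
  · exact mul_nonneg (by positivity) (Finset.sum_nonneg fun q _ =>
      mul_nonneg (mul_pos (hw _) (hw _)).le (Real.exp_nonneg _))

theorem injective_of_injective_dist {E : Type*} [NormedAddCommGroup E] {k : ℕ} (hk : 3 ≤ k)
    {μ : Fin k → E}
    (h : ∀ i j i' j' : Fin k, i < j → i' < j' →
      ‖μ i - μ j‖ = ‖μ i' - μ j'‖ → i = i' ∧ j = j') : Function.Injective μ := by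
  intro i j hij
  by_contra hne
  obtain ⟨m, hm⟩ : ∃ m, m ∉ ({i, j} : Finset (Fin k)) := by
    by_contra! hall
    have := Finset.card_le_card (fun x _ => hall x : (Finset.univ : Finset (Fin k)) ⊆ {i, j})
    have := Finset.card_le_two (a := i) (b := j)
    simp at *
    omega
  simp only [Finset.mem_insert, Finset.mem_singleton, not_or] at hm
  rcases lt_or_gt_of_ne hm.1 with h1 | h1 <;> rcases lt_or_gt_of_ne hm.2 with h2 | h2
  · exact hne (h m i m j h1 h2 (by rw [hij])).2
  · have := h m i j m h1 h2 (by rw [hij, norm_sub_rev]); grind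
  · have := h i m m j h1 h2 (by rw [hij, norm_sub_rev]); grind
  · exact hne (h i m j m h1 h2 (by rw [hij])).1

theorem sqDist_eq_iff {E : Type*} [NormedAddCommGroup E] {k : ℕ} {μ : Fin k → E}
    (h : ∀ i j i' j' : Fin k, i < j → i' < j' →
      ‖μ i - μ j‖ = ‖μ i' - μ j'‖ → i = i' ∧ j = j') (hinj : Function.Injective μ)
    {i j : Fin k} (hij : i ≠ j) (a b : Fin k) :
    ‖μ a - μ b‖ ^ 2 = ‖μ i - μ j‖ ^ 2 ↔ a = i ∧ b = j ∨ a = j ∧ b = i := by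
  constructor
  · intro hab
    rw [sq_eq_sq₀ (norm_nonneg _) (norm_nonneg _)] at hab
    have hne : a ≠ b := by
      rintro rfl
      rw [sub_self, norm_zero, eq_comm, norm_eq_zero, sub_eq_zero] at hab
      exact hij (hinj hab)
    rcases lt_or_gt_of_ne hij with h1 | h1 <;> rcases lt_or_gt_of_ne hne with h2 | h2
    · exact .inl (h _ _ _ _ h2 h1 hab)
    · exact .inr (h _ _ _ _ h2 h1 (by rw [norm_sub_rev, hab])).symm
    · exact .inr (h _ _ _ _ h2 h1 (by rw [hab, norm_sub_rev]))
    · exact .inl (h _ _ _ _ h2 h1 (by rw [norm_sub_rev, hab, norm_sub_rev])).symm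
  · rintro (⟨rfl, rfl⟩ | ⟨rfl, rfl⟩)
    · rfl
    · rw [norm_sub_rev]

theorem sum_filter_eq_two_mul {k : ℕ} {w : Fin k → ℝ} {P : Fin k × Fin k → Prop}
    [DecidablePred P] {i j : Fin k} (hij : i ≠ j)
    (hP : ∀ a b, P (a, b) ↔ a = i ∧ b = j ∨ a = j ∧ b = i) :
    ∑ q with P q, w q.1 * w q.2 = 2 * (w i * w j) := by
  have : (Finset.univ.filter P) = {(i, j), (j, i)} := by
    ext ⟨a, b⟩
    simp [hP]
  rw [this, Finset.sum_pair (by simp [hij])]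
  ring

theorem pairSqDists_eq_of_sum_filter_eq {d k : ℕ} {w w' : Fin k → ℝ} (hw : ∀ i, 0 < w i)
    {μ μ' : Fin k → EuclideanSpace ℝ (Fin d)} (hinj : Function.Injective μ)
    (h : ∀ i j i' j' : Fin k, i < j → i' < j' →
      ‖μ i - μ j‖ = ‖μ i' - μ j'‖ → i = i' ∧ j = j')
    (hsum : ∀ v : ℝ, ∑ q : Fin k × Fin k with ‖μ q.1 - μ q.2‖ ^ 2 = v, w q.1 * w q.2 =
      ∑ q : Fin k × Fin k with ‖μ' q.1 - μ' q.2‖ ^ 2 = v, w' q.1 * w' q.2) :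
    pairSqDists μ' = pairSqDists μ := by
  classical
  set P := Finset.univ.filter fun p : Fin k × Fin k => p.1 < p.2 with hP
  set D : Fin k × Fin k → ℝ := fun p => ‖μ p.1 - μ p.2‖ ^ 2 with hD
  set D' : Fin k × Fin k → ℝ := fun p => ‖μ' p.1 - μ' p.2‖ ^ 2 with hD'
  have hDinj : Set.InjOn D P := by
    rintro ⟨a, b⟩ hab ⟨i, j⟩ hij heq
    simp only [hP, Finset.coe_filter, Finset.mem_univ, true_and, Set.mem_ofPred_eq] at hab hij
    have := h a b i j hab hij ((sq_eq_sq₀ (norm_nonneg _) (norm_nonneg _)).mp heq)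
    rw [this.1, this.2]
  have hsub : P.image D ⊆ P.image D' := by
    intro v hv
    obtain ⟨⟨i, j⟩, hij, rfl⟩ := Finset.mem_image.mp hv
    have hlt : i < j := by simpa [hP] using hij
    have hpos : 0 < D (i, j) := by
      have := sub_ne_zero.mpr (hinj.ne hlt.ne)
      positivity
    have hS : 0 < ∑ q : Fin k × Fin k with D q = D (i, j), w q.1 * w q.2 :=
      Finset.sum_pos (fun q _ => mul_pos (hw _) (hw _)) ⟨(i, j), by simp⟩
    rw [hsum] at hS
    obtain ⟨⟨a, b⟩, hab, -⟩ := Finset.exists_ne_zero_of_sum_ne_zero hS.ne'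
    replace hab : D' (a, b) = D (i, j) := by simpa using hab
    rw [← hab] at hpos ⊢
    rcases lt_trichotomy a b with h1 | rfl | h1
    · exact Finset.mem_image_of_mem _ (by simpa [hP] using h1)
    · simp [hD'] at hpos
    · exact Finset.mem_image.mpr ⟨(b, a), by simpa [hP] using h1, by simp [hD', norm_sub_rev]⟩
  have hcard : (P.image D).card = P.card := Finset.card_image_of_injOn hDinj
  have heq : P.image D = P.image D' :=
    Finset.eq_of_subset_of_card_le hsub (hcard ▸ Finset.card_image_le)
  have hD'inj : Set.InjOn D' P := Finset.card_image_iff.mp (heq ▸ hcard)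
  change P.val.map D' = P.val.map D
  rw [← Finset.image_val_of_injOn hDinj, ← Finset.image_val_of_injOn hD'inj, heq]

theorem eq_of_pairwise_mul_eq {k : ℕ} (hk : 3 ≤ k) {u v : Fin k → ℝ} (hu : ∀ i, 0 < u i)
    (hv : ∀ i, 0 < v i) (h : ∀ i j, i ≠ j → u i * u j = v i * v j) (i : Fin k) : u i = v i := by
  obtain ⟨j, hj, l, hl, hjl⟩ : ∃ j ∈ Finset.univ.erase i, ∃ l ∈ Finset.univ.erase i, j ≠ l :=
    Finset.one_lt_card.mp (by simp; omega)
  have h1 := h i j (Finset.ne_of_mem_erase hj).symm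
  have h2 := h i l (Finset.ne_of_mem_erase hl).symm
  have h3 := h j l hjl
  rw [← sq_eq_sq₀ (hu i).le (hv i).le]
  refine mul_right_cancel₀ (mul_pos (hu j) (hu l)).ne' ?_
  calc u i ^ 2 * (u j * u l) = (u i * u j) * (u i * u l) := by ring
    _ = v i ^ 2 * (v j * v l) := by rw [h1, h2]; ring
    _ = _ := by rw [h3]

/-- If two identity-covariance Gaussian mixtures with positive weights have the same
distribution of distances, the first one having pairwise distinct distances between its means
and a mean configuration reconstructible from its pairwise distances, then the mixtures agree
up to a rigid motion and a permutation (both in means and weights). -/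
theorem mixture_determined_by_distance_distribution
    (d k : ℕ) (hd : 1 ≤ d) (hk : d + 2 ≤ k)
    (μ μbar : Fin k → EuclideanSpace ℝ (Fin d))
    (π πbar : Fin k → ℝ)
    (hπ : ∀ i, 0 < π i) (hπsum : ∑ i, π i = 1)
    (hπbar : ∀ i, 0 < πbar i) (hπbarsum : ∑ i, πbar i = 1)
    (hdistinct : ∀ i j i' j' : Fin k, i < j → i' < j' →
      ‖μ i - μ j‖ = ‖μ i' - μ j'‖ → i = i' ∧ j = j')
    (hrec : ∀ ν : Fin k → EuclideanSpace ℝ (Fin d),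
      pairSqDists ν = pairSqDists μ →
      ∃ (g : EuclideanSpace ℝ (Fin d) ≃ᵢ EuclideanSpace ℝ (Fin d)) (σ : Equiv.Perm (Fin k)),
        ∀ i, ν i = g (μ (σ i)))
    (hlaw : distDistrib (gaussMixture π μ) = distDistrib (gaussMixture πbar μbar)) :
    ∃ (g : EuclideanSpace ℝ (Fin d) ≃ᵢ EuclideanSpace ℝ (Fin d)) (σ : Equiv.Perm (Fin k)),
      ∀ i, μbar i = g (μ (σ i)) ∧ πbar i = π (σ i) := by
  have hk3 : 3 ≤ k := by omega
  have hinj := injective_of_injective_dist hk3 hdistinct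
  have hsum := sum_filter_sqDist_eq hπ hπbar hlaw
  obtain ⟨g, σ, hg⟩ := hrec μbar (pairSqDists_eq_of_sum_filter_eq hπ hinj hdistinct hsum)
  refine ⟨g, σ, fun i => ⟨hg i, ?_⟩⟩
  refine eq_of_pairwise_mul_eq hk3 hπbar (v := fun i => π (σ i)) (fun i => hπ _)
    (fun i j hij => ?_) i
  have hdist : ∀ a b, ‖μbar a - μbar b‖ = ‖μ (σ a) - μ (σ b)‖ := fun a b => by
    rw [hg, hg, ← dist_eq_norm, ← dist_eq_norm, g.isometry.dist_eq]
  have hσ : σ i ≠ σ j := σ.injective.ne hij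
  have H := hsum (‖μ (σ i) - μ (σ j)‖ ^ 2)
  rw [sum_filter_eq_two_mul hσ fun a b => sqDist_eq_iff hdistinct hinj hσ a b,
    sum_filter_eq_two_mul hij fun a b => by
      rw [hdist, sqDist_eq_iff hdistinct hinj hσ]; simp only [σ.injective.eq_iff]] at H
  linarith
end

section
/- Let a_1, …, a_k ∈ ℝ be nonzero and let x_1, …, x_k ∈ ℝ be pairwise distinct. Let b_1, …, b_k ∈ ℝ be nonzero and y_1, …, y_k ∈ ℝ be pairwise distinct. If the weighted power sums agree, i.e., Σ_{i=1}^k a_i x_i^n = Σ_{i=1}^k b_i y_i^n for every n = 0, 1, …, 2k − 1, then the multisets of pairs {(a_1, x_1), …, (a_k, x_k)} and {(b_1, y_1), …, (b_k, y_k)} are equal; that is, there exists a permutation σ of {1,…,k} with b_i = a_{σ(i)} and y_i = x_{σ(i)} for all i. -/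
open Polynomial in
/-- Equality of the first `N` weighted power sums extends linearly to all polynomials of degree
less than `N`. -/
theorem sum_mul_eval_eq_of_sum_mul_pow_eq {R ι κ : Type*} [CommSemiring R] [Fintype ι] [Fintype κ]
    {a x : ι → R} {b y : κ → R} {N : ℕ}
    (h : ∀ n < N, ∑ i, a i * x i ^ n = ∑ i, b i * y i ^ n) (P : R[X]) (hP : P.natDegree < N) :
    ∑ i, a i * P.eval (x i) = ∑ i, b i * P.eval (y i) := by
  simp only [eval_eq_sum_range' hP, Finset.mul_sum]
  rw [Finset.sum_comm, Finset.sum_comm (s := Finset.univ (α := κ))]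
  refine Finset.sum_congr rfl fun n hn ↦ ?_
  simp only [mul_left_comm _ (P.coeff n), ← Finset.mul_sum]
  rw [h n (Finset.mem_range.1 hn)]

open Polynomial in
/-- A sum against the nodal polynomial of all nodes but `y j`, times a further factor `Q`,
only sees the node `y j`. -/
theorem sum_mul_eval_mul_nodal_erase {R ι : Type*} [CommRing R] [Fintype ι] [DecidableEq ι]
    (b y : ι → R) (Q : R[X]) (j : ι) :
    ∑ i, b i * (Q * Lagrange.nodal (Finset.univ.erase j) y).eval (y i) =
      b j * (Q * Lagrange.nodal (Finset.univ.erase j) y).eval (y j) := by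
  refine Finset.sum_eq_single j (fun i _ hij ↦ ?_) (by simp)
  rw [eval_mul, Lagrange.eval_nodal_at_node (Finset.mem_erase.2 ⟨hij, Finset.mem_univ i⟩)]
  simp

/-- The nodal polynomial of all nodes but `y j` does not vanish at `y j`. -/
theorem eval_nodal_erase_ne_zero {R ι : Type*} [CommRing R] [IsDomain R] [Fintype ι]
    [DecidableEq ι] {y : ι → R} (hy : Function.Injective y) (j : ι) :
    (Lagrange.nodal (Finset.univ.erase j) y).eval (y j) ≠ 0 :=
  Lagrange.eval_nodal_not_at_node fun _ hi ↦ hy.ne (Finset.ne_of_mem_erase hi).symm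

/-- If two families of nonzero weights and pairwise distinct nodes have the same
weighted power sums `p_n = Σᵢ aᵢ xᵢⁿ` for `n = 0, 1, …, 2k - 1`, then the multisets of
weight-node pairs coincide. -/
theorem weighted_power_sums_determine_pairs
    (k : ℕ) (a x b y : Fin k → ℝ)
    (ha : ∀ i, a i ≠ 0) (hx : Function.Injective x)
    (hb : ∀ i, b i ≠ 0) (hy : Function.Injective y)
    (hps : ∀ n : ℕ, n < 2 * k → ∑ i, a i * x i ^ n = ∑ i, b i * y i ^ n) :
    ∃ σ : Equiv.Perm (Fin k), ∀ i, b i = a (σ i) ∧ y i = x (σ i) := by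
  have hmem : ∀ j, ∃ i, y j = x i := by
    intro j
    by_contra! hj
    have hk := j.pos
    have hdeg : (Lagrange.nodal Finset.univ x *
        Lagrange.nodal (Finset.univ.erase j) y).natDegree < 2 * k := by
      refine Polynomial.natDegree_mul_le.trans_lt ?_
      simp only [Lagrange.natDegree_nodal, Finset.card_erase_of_mem (Finset.mem_univ j),
        Finset.card_univ, Fintype.card_fin]
      omega
    have h := sum_mul_eval_eq_of_sum_mul_pow_eq hps _ hdeg
    rw [sum_mul_eval_mul_nodal_erase, Finset.sum_eq_zero fun i _ ↦ by
      rw [Polynomial.eval_mul, Lagrange.eval_nodal_at_node (Finset.mem_univ i), zero_mul, mul_zero],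
      Polynomial.eval_mul] at h
    exact mul_ne_zero (hb j) (mul_ne_zero (Lagrange.eval_nodal_not_at_node fun i _ ↦ hj i)
      (eval_nodal_erase_ne_zero hy j)) h.symm
  choose τ hτ using hmem
  have hτi : Function.Injective τ := fun i j hij ↦ hy (by rw [hτ, hτ, hij])
  let σ := Equiv.ofBijective τ (Finite.injective_iff_bijective.1 hτi)
  refine ⟨σ, fun j ↦ ⟨?_, hτ j⟩⟩
  have hps' : ∀ n < 2 * k, ∑ i, a (σ i) * y i ^ n = ∑ i, b i * y i ^ n := by
    intro n hn
    rw [← hps n hn, ← Equiv.sum_comp σ fun i ↦ a i * x i ^ n]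
    exact Finset.sum_congr rfl fun i _ ↦ by rw [hτ i]; rfl
  have hk := j.pos
  have hdeg : (1 * Lagrange.nodal (Finset.univ.erase j) y).natDegree < 2 * k := by
    simp only [one_mul, Lagrange.natDegree_nodal, Finset.card_erase_of_mem (Finset.mem_univ j),
      Finset.card_univ, Fintype.card_fin]
    omega
  have h := sum_mul_eval_eq_of_sum_mul_pow_eq hps' _ hdeg
  rw [sum_mul_eval_mul_nodal_erase, sum_mul_eval_mul_nodal_erase, one_mul] at h
  exact (mul_right_cancel₀ (eval_nodal_erase_ne_zero hy j) h).symm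
end

section
/- Let μ_1, …, μ_k ∈ ℝ^d, let π_1, …, π_k > 0 with Σπ_i = 1, and let ρ be the Gaussian mixture with means μ_i, weights π_i, and identity covariances. Let X_1, X_2 be independent samples from ρ and Δ = ‖X_1 − X_2‖². Then for every real t with |t| sufficiently small, the moment generating function of Δ admits the absolutely convergent expansion E[exp(tΔ)] = Σ_{n=0}^∞ m_n · t^n / (1 − 4t)^{n + d/2}, where m_n = Σ_{i=1}^k Σ_{j=1}^k π_i π_j ‖μ_i − μ_j‖^{2n} / n!. -/
open MeasureTheory

section GaussianIntegrals

variable {V : Type*} [NormedAddCommGroup V] [InnerProductSpace ℝ V]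

/-- Completing the square in a weighted sum of two squared distances. -/
theorem mul_sq_dist_add_mul_sq_dist {p q : ℝ} (h : p + q ≠ 0) (a c x : V) :
    p * ‖x - a‖ ^ 2 + q * ‖x - c‖ ^ 2 =
      (p + q) * ‖x - (p + q)⁻¹ • (p • a + q • c)‖ ^ 2 + p * q / (p + q) * ‖a - c‖ ^ 2 := by
  simp only [← real_inner_self_eq_norm_sq, inner_sub_left, inner_sub_right, inner_add_left,
    inner_add_right, real_inner_smul_left, real_inner_smul_right, real_inner_comm a x,
    real_inner_comm c x, real_inner_comm a c]
  field_simp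
  ring

variable [FiniteDimensional ℝ V] [MeasurableSpace V] [BorelSpace V]

theorem integral_exp_neg_two_sq_dist {p q : ℝ} (h : 0 < p + q) (a c : V) :
    ∫ x : V, Real.exp (-(p * ‖x - a‖ ^ 2 + q * ‖x - c‖ ^ 2)) =
      (Real.pi / (p + q)) ^ (Module.finrank ℝ V / 2 : ℝ) *
        Real.exp (-(p * q / (p + q) * ‖a - c‖ ^ 2)) := by
  simp_rw [mul_sq_dist_add_mul_sq_dist h.ne' a c, neg_add, Real.exp_add, ← neg_mul (p + q)]
  rw [integral_mul_const,
    integral_sub_right_eq_self (fun x : V => Real.exp (-(p + q) * ‖x‖ ^ 2)),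
    GaussianFourier.integral_rexp_neg_mul_sq_norm h]

theorem integrable_exp_neg_two_sq_dist {p q : ℝ} (h : 0 < p + q) (a c : V) :
    Integrable fun x : V => Real.exp (-(p * ‖x - a‖ ^ 2 + q * ‖x - c‖ ^ 2)) := by
  refine Integrable.of_integral_ne_zero ?_
  rw [integral_exp_neg_two_sq_dist h]
  have := Real.pi_pos
  positivity

theorem integral_exp_sq_dist_add_gaussian {t : ℝ} (ht : t < 1 / 2) (b x : V) :
    ∫ y : V, Real.exp (t * ‖x - y‖ ^ 2 - ‖y - b‖ ^ 2 / 2) =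
      (Real.pi / (1 / 2 - t)) ^ (Module.finrank ℝ V / 2 : ℝ) *
        Real.exp (t / (1 - 2 * t) * ‖x - b‖ ^ 2) := by
  have h : 0 < -t + 1 / 2 := by linarith
  have h' : 1 - 2 * t ≠ 0 := by linarith
  convert integral_exp_neg_two_sq_dist h x b using 3 with y
  · rw [norm_sub_rev x y]
    ring_nf
  · ring_nf
  · rw [show -t + 1 / 2 = (1 - 2 * t) / 2 by ring]
    field_simp

theorem integrable_exp_sq_dist_add_gaussian {t : ℝ} (ht : t < 1 / 2) (b x : V) :
    Integrable fun y : V => Real.exp (t * ‖x - y‖ ^ 2 - ‖y - b‖ ^ 2 / 2) := by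
  convert integrable_exp_neg_two_sq_dist (show 0 < -t + 1 / 2 by linarith) x b using 3 with y
  rw [norm_sub_rev x y]
  ring_nf

theorem integrable_exp_sq_dist_gaussian_prod {t : ℝ} (ht : t < 1 / 4) (a b : V) :
    Integrable (fun p : V × V =>
      Real.exp (-‖p.1 - a‖ ^ 2 / 2) * Real.exp (t * ‖p.1 - p.2‖ ^ 2 - ‖p.2 - b‖ ^ 2 / 2))
      (volume.prod volume) := by
  have h₂ : t < 1 / 2 := by linarith
  rw [integrable_prod_iff (by fun_prop)]
  refine ⟨.of_forall fun x => (integrable_exp_sq_dist_add_gaussian h₂ b x).const_mul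
    (Real.exp (-‖x - a‖ ^ 2 / 2)), ?_⟩
  simp_rw [norm_mul, Real.norm_eq_abs, Real.abs_exp, integral_const_mul,
    integral_exp_sq_dist_add_gaussian h₂]
  convert (integrable_exp_sq_dist_add_gaussian (t := t / (1 - 2 * t)) ?_ a b).const_mul
    ((Real.pi / (1 / 2 - t)) ^ (Module.finrank ℝ V / 2 : ℝ)) using 2 with x
  · rw [mul_left_comm, ← Real.exp_add, norm_sub_rev b x]
    ring_nf
  · rw [div_lt_iff₀] <;> linarith

theorem integral_exp_sq_dist_gaussian_prod {t : ℝ} (ht : t < 1 / 4) (a b : V) :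
    ∫ p : V × V, Real.exp (-‖p.1 - a‖ ^ 2 / 2) *
        Real.exp (t * ‖p.1 - p.2‖ ^ 2 - ‖p.2 - b‖ ^ 2 / 2) ∂(volume.prod volume) =
      (4 * Real.pi ^ 2 / (1 - 4 * t)) ^ (Module.finrank ℝ V / 2 : ℝ) *
        Real.exp (t / (1 - 4 * t) * ‖a - b‖ ^ 2) := by
  have h₂ : t < 1 / 2 := by linarith
  have h₃ : 0 < 1 - 2 * t := by linarith
  have h₄ : 0 < 1 - 4 * t := by linarith
  have hs : t / (1 - 2 * t) < 1 / 2 := by rw [div_lt_iff₀] <;> linarith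
  rw [integral_prod _ (integrable_exp_sq_dist_gaussian_prod ht a b)]
  simp_rw [integral_const_mul, integral_exp_sq_dist_add_gaussian h₂]
  have key (x : V) : Real.exp (-‖x - a‖ ^ 2 / 2) *
      ((Real.pi / (1 / 2 - t)) ^ (Module.finrank ℝ V / 2 : ℝ) *
        Real.exp (t / (1 - 2 * t) * ‖x - b‖ ^ 2)) =
      (Real.pi / (1 / 2 - t)) ^ (Module.finrank ℝ V / 2 : ℝ) *
        Real.exp (t / (1 - 2 * t) * ‖b - x‖ ^ 2 - ‖x - a‖ ^ 2 / 2) := by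
    rw [mul_left_comm, ← Real.exp_add, norm_sub_rev b x]
    ring_nf
  simp_rw [key, integral_const_mul]
  rw [integral_exp_sq_dist_add_gaussian hs, ← mul_assoc,
    ← Real.mul_rpow (div_nonneg Real.pi_pos.le (by linarith))
      (div_nonneg Real.pi_pos.le (by linarith)), norm_sub_rev b a]
  have e₁ : 1 / 2 - t = (1 - 2 * t) / 2 := by ring
  have e₂ : 1 / 2 - t / (1 - 2 * t) = (1 - 4 * t) / (2 * (1 - 2 * t)) := by
    field_simp
    ring
  have e₃ : 1 - 2 * (t / (1 - 2 * t)) = (1 - 4 * t) / (1 - 2 * t) := by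
    field_simp
    ring
  rw [e₁, e₂, e₃]
  have e₄ : Real.pi / ((1 - 2 * t) / 2) * (Real.pi / ((1 - 4 * t) / (2 * (1 - 2 * t)))) =
      4 * Real.pi ^ 2 / (1 - 4 * t) := by
    field_simp
    ring
  have e₅ : t / (1 - 2 * t) / ((1 - 4 * t) / (1 - 2 * t)) = t / (1 - 4 * t) :=
    div_div_div_cancel_right₀ h₃.ne' _ _
  rw [e₄, e₅]

end GaussianIntegrals

section GaussianMixture

variable {d k : ℕ}

theorem continuous_gaussMixture (w : Fin k → ℝ) (μ : Fin k → EuclideanSpace ℝ (Fin d)) :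
    Continuous (gaussMixture w μ) := by
  unfold gaussMixture
  fun_prop

theorem gaussMixture_nonneg {w : Fin k → ℝ} (hw : ∀ i, 0 ≤ w i)
    (μ : Fin k → EuclideanSpace ℝ (Fin d)) (x : EuclideanSpace ℝ (Fin d)) :
    0 ≤ gaussMixture w μ x :=
  Finset.sum_nonneg fun i _ => mul_nonneg (hw i) (by positivity)

/-- Closed form of the moment generating function of the squared distance between two
independent samples of a Gaussian mixture. -/
theorem integral_exp_sq_dist_gaussMixture {w : Fin k → ℝ} (hw : ∀ i, 0 ≤ w i)
    (μ : Fin k → EuclideanSpace ℝ (Fin d)) {t : ℝ} (ht : t < 1 / 4) :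
    ∫ p : EuclideanSpace ℝ (Fin d) × EuclideanSpace ℝ (Fin d), Real.exp (t * ‖p.1 - p.2‖ ^ 2)
      ∂((volume.withDensity fun x => ENNReal.ofReal (gaussMixture w μ x)).prod
          (volume.withDensity fun x => ENNReal.ofReal (gaussMixture w μ x))) =
      ∑ i, ∑ j, w i * w j * (((1 - 4 * t) ^ ((d : ℝ) / 2))⁻¹ *
        Real.exp (t / (1 - 4 * t) * ‖μ i - μ j‖ ^ 2)) := by
  have h₄ : 0 < 1 - 4 * t := by linarith
  have hg : Measurable (gaussMixture w μ) := (continuous_gaussMixture w μ).measurable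
  have hm := hg.ennreal_ofReal
  rw [prod_withDensity hm hm, integral_withDensity_eq_integral_toReal_smul (by fun_prop)
    (.of_forall fun p => ENNReal.mul_lt_top ENNReal.ofReal_lt_top ENNReal.ofReal_lt_top)]
  have expand (p : EuclideanSpace ℝ (Fin d) × EuclideanSpace ℝ (Fin d)) :
      (ENNReal.ofReal (gaussMixture w μ p.1) * ENNReal.ofReal (gaussMixture w μ p.2)).toReal •
        Real.exp (t * ‖p.1 - p.2‖ ^ 2) =
      ∑ i, ∑ j, (w i * w j * ((2 * Real.pi) ^ (-(d : ℝ) / 2)) ^ 2) *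
        (Real.exp (-‖p.1 - μ i‖ ^ 2 / 2) *
          Real.exp (t * ‖p.1 - p.2‖ ^ 2 - ‖p.2 - μ j‖ ^ 2 / 2)) := by
    rw [ENNReal.toReal_mul, ENNReal.toReal_ofReal (gaussMixture_nonneg hw μ _),
      ENNReal.toReal_ofReal (gaussMixture_nonneg hw μ _), gaussMixture, gaussMixture,
      Finset.sum_mul_sum, smul_eq_mul, Finset.sum_mul]
    simp_rw [Finset.sum_mul, sub_eq_add_neg (t * _), Real.exp_add, neg_div]
    refine Finset.sum_congr rfl fun i _ => Finset.sum_congr rfl fun j _ => ?_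
    ring
  have hint (i j : Fin k) := (integrable_exp_sq_dist_gaussian_prod ht (μ i) (μ j)).const_mul
    (w i * w j * ((2 * Real.pi) ^ (-(d : ℝ) / 2)) ^ 2)
  have hconst : ((2 * Real.pi) ^ (-(d : ℝ) / 2)) ^ 2 *
      (4 * Real.pi ^ 2 / (1 - 4 * t)) ^ ((d : ℝ) / 2) = ((1 - 4 * t) ^ ((d : ℝ) / 2))⁻¹ := by
    rw [Real.div_rpow (by positivity) h₄.le, neg_div, Real.rpow_neg (by positivity),
      show 4 * Real.pi ^ 2 = (2 * Real.pi) ^ 2 by ring, ← Real.rpow_natCast_mul (by positivity),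
      mul_comm ((2 : ℕ) : ℝ), Real.rpow_mul_natCast (by positivity)]
    have : 0 < (2 * Real.pi) ^ ((d : ℝ) / 2) := by positivity
    field_simp
  simp_rw [expand]
  rw [integral_finsetSum _ fun i _ => integrable_finsetSum _ fun j _ => hint i j]
  refine Finset.sum_congr rfl fun i _ => ?_
  rw [integral_finsetSum _ fun j _ => hint i j]
  refine Finset.sum_congr rfl fun j _ => ?_
  rw [integral_const_mul, integral_exp_sq_dist_gaussian_prod ht, finrank_euclideanSpace_fin,
    ← hconst]
  ring

end GaussianMixture

/-- For `X₁, X₂` independent samples from an identity-covariance Gaussian mixture and all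
sufficiently small `|t|`, the moment generating function of `Δ = ‖X₁ - X₂‖²` admits the
absolutely convergent expansion `E[exp(tΔ)] = Σₙ mₙ tⁿ / (1-4t)^{n + d/2}` with
`mₙ = Σᵢ Σⱼ πᵢ πⱼ ‖μᵢ - μⱼ‖^{2n} / n!`. -/
theorem mgf_sq_dist_mixture_expansion
    (d k : ℕ) (μ : Fin k → EuclideanSpace ℝ (Fin d)) (π : Fin k → ℝ)
    (hπ : ∀ i, 0 < π i) (hπsum : ∑ i, π i = 1)
    (m : ℕ → ℝ)
    (hm : ∀ n, m n = ∑ i, ∑ j, π i * π j * ‖μ i - μ j‖ ^ (2 * n) / (n.factorial : ℝ)) :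
    ∃ ε > (0 : ℝ), ∀ t : ℝ, |t| < ε →
      Summable (fun n : ℕ => |m n * t ^ n / (1 - 4 * t) ^ ((n : ℝ) + (d : ℝ) / 2)|) ∧
      HasSum (fun n : ℕ => m n * t ^ n / (1 - 4 * t) ^ ((n : ℝ) + (d : ℝ) / 2))
        (∫ p : EuclideanSpace ℝ (Fin d) × EuclideanSpace ℝ (Fin d),
          Real.exp (t * ‖p.1 - p.2‖ ^ 2)
          ∂((volume.withDensity fun x => ENNReal.ofReal (gaussMixture π μ x)).prod
              (volume.withDensity fun x => ENNReal.ofReal (gaussMixture π μ x)))) := by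
  refine ⟨1 / 4, by norm_num, fun t htabs => ?_⟩
  have ht : t < 1 / 4 := (le_abs_self t).trans_lt htabs
  have h₄ : 0 < 1 - 4 * t := by linarith
  suffices h : HasSum (fun n : ℕ => m n * t ^ n / (1 - 4 * t) ^ ((n : ℝ) + (d : ℝ) / 2)) _ from
    ⟨h.summable.abs, h⟩
  rw [integral_exp_sq_dist_gaussMixture (fun i => (hπ i).le) μ ht]
  have hterm (n : ℕ) : m n * t ^ n / (1 - 4 * t) ^ ((n : ℝ) + (d : ℝ) / 2) =
      ∑ i, ∑ j, π i * π j * (((1 - 4 * t) ^ ((d : ℝ) / 2))⁻¹ *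
        ((t / (1 - 4 * t) * ‖μ i - μ j‖ ^ 2) ^ n / n.factorial)) := by
    rw [hm, Real.rpow_add h₄, Real.rpow_natCast, Finset.sum_mul, Finset.sum_div]
    refine Finset.sum_congr rfl fun i _ => ?_
    rw [Finset.sum_mul, Finset.sum_div]
    refine Finset.sum_congr rfl fun j _ => ?_
    rw [mul_pow, div_pow, ← pow_mul]
    field_simp
  simp_rw [hterm]
  refine hasSum_sum fun i _ => hasSum_sum fun j _ => ((HasSum.mul_left _ ?_).mul_left _)
  rw [Real.exp_eq_exp_ℝ]
  exact NormedSpace.expSeries_div_hasSum_exp _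
end
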